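/- arXiv:1712.05985 — 3 statements merged into one kernel-verified Lean document; each statement's English description precedes it below -/
import Mathlib

section
/- Let H be a real Hilbert space, f : H → ℝ a convex Fréchet-differentiable function, and E = {σ ∈ H : f(σ) ≤ 0} its sublevel set. Assume the Slater condition: there exists σ₀ ∈ H with f(σ₀) < 0. Then for every σ ∈ E, the normal cone satisfies N_E(σ) = {λ ∇f(σ) : λ ≥ 0 and λ f(σ) = 0}, where ∇f(σ) ∈ H is the gradient of f at σ; in particular every v ∈ N_E(σ) is of the form v = λ ∇f(σ) with a Lagrange multiplier λ obeying the Kuhn–Tucker complementarity conditions λ ≥ 0, f(σ) ≤ 0, λ f(σ) = 0. -/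
open scoped RealInnerProductSpace

open Filter Topology

section

variable {H : Type*} [NormedAddCommGroup H] [InnerProductSpace ℝ H] [CompleteSpace H]
  {f : H → ℝ} {x : H}

theorem DifferentiableAt.tendsto_slope_inner_gradient (hf : DifferentiableAt ℝ f x) (d : H) :
    Tendsto (fun t : ℝ => t⁻¹ • (f (x + t • d) - f x)) (𝓝[>] 0) (𝓝 ⟪gradient f x, d⟫) := by
  have h := (hf.hasGradientAt.hasFDerivAt.hasLineDerivAt d).tendsto_slope_zero_right
  simpa using h

/-- The tangent hyperplane of a convex function lies below its graph. -/
theorem ConvexOn.inner_gradient_le_sub (hconv : ConvexOn ℝ Set.univ f)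
    (hf : DifferentiableAt ℝ f x) (y : H) : ⟪gradient f x, y - x⟫ ≤ f y - f x := by
  refine le_of_tendsto (hf.tendsto_slope_inner_gradient (y - x)) ?_
  filter_upwards [Ioc_mem_nhdsGT (zero_lt_one' ℝ)] with t ht
  have h := hconv.2 (Set.mem_univ x) (Set.mem_univ y) (sub_nonneg.2 ht.2) ht.1.le (by ring)
  have hxy : (1 - t) • x + t • y = x + t • (y - x) := by module
  rw [hxy, smul_eq_mul, smul_eq_mul] at h
  rw [smul_eq_mul, inv_mul_le_iff₀ ht.1]
  linarith

/-- A direction of strict descent at a zero of `f` enters the sublevel set of `f`. -/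
theorem DifferentiableAt.exists_pos_apply_add_smul_nonpos (hf : DifferentiableAt ℝ f x)
    (hx : f x = 0) {d : H} (hd : ⟪gradient f x, d⟫ < 0) : ∃ t : ℝ, 0 < t ∧ f (x + t • d) ≤ 0 := by
  have h := (hf.tendsto_slope_inner_gradient d).eventually_lt_const hd
  obtain ⟨t, hneg, ht⟩ := (h.and self_mem_nhdsWithin).exists
  refine ⟨t, ht, ?_⟩
  rw [hx, sub_zero, smul_eq_mul, inv_mul_lt_iff₀ ht, mul_zero] at hneg
  exact hneg.le

/-- Every direction at a point where a continuous `f` is negative enters the sublevel set. -/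
theorem ContinuousAt.exists_pos_apply_add_smul_nonpos {E : Type*} [NormedAddCommGroup E]
    [NormedSpace ℝ E] {f : E → ℝ} {x : E} (hf : ContinuousAt f x) (hx : f x < 0) (d : E) :
    ∃ t : ℝ, 0 < t ∧ f (x + t • d) ≤ 0 := by
  have hline : Tendsto (fun t : ℝ => x + t • d) (𝓝[>] 0) (𝓝 x) := by
    have : Continuous fun t : ℝ => x + t • d := by fun_prop
    simpa using (this.tendsto 0).mono_left nhdsWithin_le_nhds
  have h := (hf.tendsto.comp hline).eventually_lt_const hx
  obtain ⟨t, hneg, ht⟩ := (h.and self_mem_nhdsWithin).exists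
  exact ⟨t, ht, le_of_lt hneg⟩

end

/-- Farkas' lemma for a single strict inequality. -/
theorem exists_nonneg_eq_smul_of_forall_inner_neg {H : Type*} [NormedAddCommGroup H]
    [InnerProductSpace ℝ H] {g v : H} (hg : g ≠ 0) (h : ∀ d : H, ⟪g, d⟫ < 0 → ⟪v, d⟫ ≤ 0) :
    ∃ l : ℝ, 0 ≤ l ∧ v = l • g := by
  have hgg : 0 < ⟪g, g⟫ := real_inner_self_pos.2 hg
  have hvg : 0 ≤ ⟪v, g⟫ := by
    have := h (-g) (by simpa using hgg)
    simpa using this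
  set l : ℝ := ⟪v, g⟫ / ⟪g, g⟫ with hl
  have hlg : l * ⟪g, g⟫ = ⟪v, g⟫ := div_mul_cancel₀ _ hgg.ne'
  refine ⟨l, div_nonneg hvg hgg.le, ?_⟩
  have hgw : ⟪g, v - l • g⟫ = 0 := by
    rw [inner_sub_right, real_inner_smul_right, real_inner_comm, hlg, sub_self]
  have hvw : ⟪v, v - l • g⟫ = ⟪v - l • g, v - l • g⟫ := by
    rw [inner_sub_left v (l • g), real_inner_smul_left, hgw, mul_zero, sub_zero]
  have hbound : ∀ ε : ℝ, 0 < ε → ⟪v - l • g, v - l • g⟫ ≤ ε * ⟪v, g⟫ := by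
    intro ε hε
    have := h ((v - l • g) - ε • g) (by
      rw [inner_sub_right, hgw, real_inner_smul_right, zero_sub]
      exact neg_neg_of_pos (mul_pos hε hgg))
    rw [inner_sub_right, hvw, real_inner_smul_right] at this
    linarith
  have hlim : Tendsto (fun ε : ℝ => ε * ⟪v, g⟫) (𝓝[>] 0) (𝓝 0) := by
    have : Continuous fun ε : ℝ => ε * ⟪v, g⟫ := by fun_prop
    simpa using (this.tendsto 0).mono_left nhdsWithin_le_nhds
  have hle : ⟪v - l • g, v - l • g⟫ ≤ 0 :=
    ge_of_tendsto hlim (eventually_mem_nhdsWithin.mono hbound)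
  exact sub_eq_zero.1 (real_inner_self_nonpos.1 hle)

/-- For a convex Fréchet-differentiable `f : H → ℝ` on a real Hilbert space
satisfying the Slater condition, the normal cone to the sublevel set
`E = {σ | f σ ≤ 0}` at any `σ ∈ E` consists exactly of the vectors
`λ • ∇f(σ)` with `λ ≥ 0` and `λ f(σ) = 0` (Kuhn–Tucker conditions). -/
theorem normalCone_sublevel_eq_lagrange
    {H : Type*} [NormedAddCommGroup H] [InnerProductSpace ℝ H] [CompleteSpace H]
    (f : H → ℝ) (hconv : ConvexOn ℝ Set.univ f) (hdiff : ∀ x : H, DifferentiableAt ℝ f x)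
    (hslater : ∃ σ₀ : H, f σ₀ < 0) (σ : H) (hσ : σ ∈ {x : H | f x ≤ 0}) :
    {v : H | ∀ σ' ∈ {x : H | f x ≤ 0}, ⟪v, σ' - σ⟫ ≤ 0}
      = {v : H | ∃ l : ℝ, 0 ≤ l ∧ l * f σ = 0 ∧ v = l • gradient f σ} := by
  have hfeas : ∀ v d : H, (∀ σ' ∈ {x : H | f x ≤ 0}, ⟪v, σ' - σ⟫ ≤ 0) →
      (∃ t : ℝ, 0 < t ∧ f (σ + t • d) ≤ 0) → ⟪v, d⟫ ≤ 0 := by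
    rintro v d hv ⟨t, ht, hft⟩
    have := hv _ hft
    rw [add_sub_cancel_left, real_inner_smul_right] at this
    exact nonpos_of_mul_nonpos_right this ht
  ext v
  constructor
  · intro hv
    rcases lt_or_eq_of_le (show f σ ≤ 0 from hσ) with hneg | hzero
    · have hvv := hfeas v v hv
        ((hdiff σ).continuousAt.exists_pos_apply_add_smul_nonpos hneg v)
      exact ⟨0, le_rfl, zero_mul _, by rw [zero_smul]; exact real_inner_self_nonpos.1 hvv⟩
    · obtain ⟨σ₀, hσ₀⟩ := hslater
      have hg : gradient f σ ≠ 0 := by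
        intro h0
        have := hconv.inner_gradient_le_sub (hdiff σ) σ₀
        rw [h0, inner_zero_left, hzero] at this
        linarith
      obtain ⟨l, hl, rfl⟩ := exists_nonneg_eq_smul_of_forall_inner_neg hg fun d hd =>
        hfeas v d hv ((hdiff σ).exists_pos_apply_add_smul_nonpos hzero hd)
      exact ⟨l, hl, by rw [hzero, mul_zero], rfl⟩
  · rintro ⟨l, hl, hcompl, rfl⟩ y hy
    have hle := mul_le_mul_of_nonneg_left (hconv.inner_gradient_le_sub (hdiff σ) y) hl
    have hfy := mul_nonpos_of_nonneg_of_nonpos hl (show f y ≤ 0 from hy)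
    rw [real_inner_smul_left]
    linarith
end

section
/- Let (Ω, 𝒜) be a measurable space, X a finite-dimensional real normed vector space, and m : 𝒜 → X a vector measure (m(∅) = 0 and m is countably additive in norm). Then m is majorable: there exists a finite nonnegative measure μ on (Ω, 𝒜) such that ‖m(A)‖ ≤ μ(A) for every A ∈ 𝒜. -/
open MeasureTheory

/-- A vector measure with values in a finite-dimensional real normed space is
majorable: there is a finite nonnegative measure `μ` with `‖m(A)‖ ≤ μ(A)` for
every measurable set `A`. -/
theorem vectorMeasure_majorable
    {Ω : Type*} [MeasurableSpace Ω] {X : Type*} [NormedAddCommGroup X]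
    [NormedSpace ℝ X] [FiniteDimensional ℝ X]
    (m : VectorMeasure Ω X) :
    ∃ μ : Measure Ω, IsFiniteMeasure μ ∧
      ∀ A : Set Ω, MeasurableSet A → ‖m A‖ ≤ (μ A).toReal := by
  let b := Module.finBasis ℝ X
  let s (i : Fin (Module.finrank ℝ X)) : SignedMeasure Ω :=
    m.mapRange (b.coord i).toAddMonoidHom (b.coord i).continuous_of_finiteDimensional
  have hs (i A) : s i A = b.repr (m A) i := rfl
  let μ : Measure Ω := ∑ i, ‖b i‖₊ • (s i).totalVariation
  have hμ : IsFiniteMeasure μ := by infer_instance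
  refine ⟨μ, hμ, fun A _ ↦ ?_⟩
  rw [← ENNReal.ofReal_le_iff_le_toReal (measure_ne_top μ A), ofReal_norm]
  calc ‖m A‖ₑ = ‖∑ i, b.repr (m A) i • b i‖ₑ := by rw [b.sum_repr]
    _ ≤ ∑ i, ‖b.repr (m A) i • b i‖ₑ := enorm_sum_le _ _
    _ ≤ ∑ i, ‖b i‖₊ * (s i).totalVariation A := by
      gcongr with i
      rw [enorm_smul, mul_comm, ← hs, enorm_eq_nnnorm (b i)]
      gcongr
      exact (s i).enorm_le_totalVariation A
    _ = μ A := by simp only [μ, Measure.finsetSum_apply, Measure.smul_apply, ENNReal.smul_def, smul_eq_mul]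
end

section
/- Let (Ω, 𝒜) be a measurable space, X a finite-dimensional real normed vector space, and m : 𝒜 → X a vector measure (m(∅) = 0 and m is countably additive in norm). Then m possesses a density with respect to a nonnegative measure: there exist a finite nonnegative measure μ on (Ω, 𝒜) and a μ-integrable function g : Ω → X with ‖g(ω)‖ ≤ 1 for μ-almost every ω, such that m(A) = ∫_A g dμ for every A ∈ 𝒜. -/
open MeasureTheory

namespace MeasureTheory

/-- A signed measure is the indefinite integral of an integrable real function with respect to any
finite measure dominating its total variation. -/
theorem SignedMeasure.apply_eq_setIntegral_rnDeriv {Ω : Type*} [MeasurableSpace Ω]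
    (s : SignedMeasure Ω) {μ : Measure Ω} [IsFiniteMeasure μ] (hs : s.totalVariation ≤ μ)
    {A : Set Ω} (hA : MeasurableSet A) : s A = ∫ ω in A, s.rnDeriv μ ω ∂μ := by
  have hac : s ≪ᵥ μ.toENNRealVectorMeasure :=
    VectorMeasure.AbsolutelyContinuous.mk fun t ht h ↦ s.null_of_totalVariation_zero <|
      le_zero_iff.1 <| (hs t).trans_eq <| by
        rwa [Measure.toENNRealVectorMeasure_apply_measurable ht] at h
  rw [← withDensityᵥ_apply (s.integrable_rnDeriv μ) hA,
    (s.absolutelyContinuous_iff_withDensityᵥ_rnDeriv_eq μ).1 hac]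

/-- A vector measure with values in a finite-dimensional space is the indefinite integral of an
integrable function with respect to a finite measure. -/
theorem VectorMeasure.exists_integrable_density {Ω : Type*} [MeasurableSpace Ω] {X : Type*}
    [NormedAddCommGroup X] [NormedSpace ℝ X] [FiniteDimensional ℝ X] (m : VectorMeasure Ω X) :
    ∃ μ : Measure Ω, IsFiniteMeasure μ ∧ ∃ f : Ω → X, Integrable f μ ∧
      ∀ A : Set Ω, MeasurableSet A → m A = ∫ ω in A, f ω ∂μ := by
  let b := Module.finBasis ℝ X
  let s (i : Fin (Module.finrank ℝ X)) : SignedMeasure Ω :=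
    m.mapRange (b.coord i).toAddMonoidHom (b.coord i).continuous_of_finiteDimensional
  let μ : Measure Ω := ∑ i, (s i).totalVariation
  have hle (i) : (s i).totalVariation ≤ μ :=
    Finset.single_le_sum (f := fun i ↦ (s i).totalVariation) (fun _ _ ↦ Measure.zero_le _)
      (Finset.mem_univ i)
  have hint (i) : Integrable (fun ω ↦ (s i).rnDeriv μ ω • b i) μ :=
    ((s i).integrable_rnDeriv μ).smul_const (b i)
  refine ⟨μ, inferInstance, fun ω ↦ ∑ i, (s i).rnDeriv μ ω • b i,
    integrable_finsetSum _ fun i _ ↦ hint i, fun A hA ↦ ?_⟩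
  rw [MeasureTheory.integral_finsetSum _ fun i _ ↦ (hint i).integrableOn]
  simp_rw [_root_.integral_smul_const, ← (s _).apply_eq_setIntegral_rnDeriv (hle _) hA]
  exact (b.sum_repr (m A)).symm

/-- An indefinite integral `∫_A f dμ` is also the indefinite integral of the normalized function
`f / ‖f‖` with respect to the measure with density `‖f‖`. -/
theorem setIntegral_withDensity_nnnorm_inv_norm_smul {Ω : Type*} [MeasurableSpace Ω] {X : Type*}
    [NormedAddCommGroup X] [NormedSpace ℝ X] {μ : Measure Ω} {f : Ω → X}
    (hf : AEStronglyMeasurable f μ) {A : Set Ω} (hA : MeasurableSet A) :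
    ∫ ω in A, ‖f ω‖⁻¹ • f ω ∂μ.withDensity (fun ω ↦ ‖f ω‖₊) = ∫ ω in A, f ω ∂μ := by
  rw [setIntegral_withDensity_eq_setIntegral_smul₀ hf.nnnorm.aemeasurable.restrict _ hA]
  congr 1 with ω
  by_cases h : f ω = 0
  · simp [h]
  · rw [NNReal.smul_def, coe_nnnorm, smul_inv_smul₀ (norm_ne_zero_iff.2 h)]

end MeasureTheory

/-- A vector measure with values in a finite-dimensional real normed space
possesses a density: there are a finite nonnegative measure `μ` and a
`μ`-integrable function `g` with `‖g‖ ≤ 1` `μ`-a.e. such that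
`m(A) = ∫_A g dμ` for every measurable set `A`. -/
theorem vectorMeasure_exists_density
    {Ω : Type*} [MeasurableSpace Ω] {X : Type*} [NormedAddCommGroup X]
    [NormedSpace ℝ X] [FiniteDimensional ℝ X]
    (m : VectorMeasure Ω X) :
    ∃ μ : Measure Ω, IsFiniteMeasure μ ∧
      ∃ g : Ω → X, Integrable g μ ∧ (∀ᵐ ω ∂μ, ‖g ω‖ ≤ 1) ∧
        ∀ A : Set Ω, MeasurableSet A → m A = ∫ ω in A, g ω ∂μ := by
  obtain ⟨ν, hν, f, hf, hm⟩ := m.exists_integrable_density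
  have hle (ω : Ω) : ‖‖f ω‖⁻¹ • f ω‖ ≤ 1 := by
    simpa [norm_smul] using inv_mul_le_one (a := ‖f ω‖)
  have hfin : IsFiniteMeasure (ν.withDensity fun ω ↦ ‖f ω‖₊) :=
    isFiniteMeasure_withDensity hf.hasFiniteIntegral.ne
  refine ⟨ν.withDensity fun ω ↦ ‖f ω‖₊, hfin, fun ω ↦ ‖f ω‖⁻¹ • f ω, ?_, .of_forall hle,
    fun A hA ↦ (hm A hA).trans
      (setIntegral_withDensity_nnnorm_inv_norm_smul hf.aestronglyMeasurable hA).symm⟩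
  have hac : AEStronglyMeasurable f (ν.withDensity fun ω ↦ ‖f ω‖₊) :=
    hf.aestronglyMeasurable.mono_ac (withDensity_absolutelyContinuous _ _)
  exact .of_bound (hac.norm.aemeasurable.inv.aestronglyMeasurable.smul hac) 1 (.of_forall hle)
end
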